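/- Let S be a conical refinement commutative monoid whose algebraic preorder is antisymmetric and which has general comparability. Then every pair of elements of S has an infimum, and every pair of elements of S has a supremum (note that any pair {a, b} is majorized by a + b in a total monoid). -/

import Mathlib

namespace PaperCDS

variable {M : Type*} [AddCommMonoid M]

/-- The algebraic preorder: `a ≤ b` iff `a + c = b` for some `c`. -/
def algLe (a b : M) : Prop := ∃ c : M, a + c = b

/-- `S` is conical if `a + b = 0` implies `a = 0` and `b = 0`. -/
def Conical (M : Type*) [AddCommMonoid M] : Prop :=
  ∀ a b : M, a + b = 0 → a = 0 ∧ b = 0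

/-- The refinement property. -/
def Refinement (M : Type*) [AddCommMonoid M] : Prop :=
  ∀ a₀ a₁ b₀ b₁ : M, a₀ + a₁ = b₀ + b₁ →
    ∃ c₀₀ c₀₁ c₁₀ c₁₁ : M,
      a₀ = c₀₀ + c₀₁ ∧ a₁ = c₁₀ + c₁₁ ∧ b₀ = c₀₀ + c₁₀ ∧ b₁ = c₀₁ + c₁₁

/-- Orthogonality: `a ⊥ b` iff the only `x` with `x ≤ a` and `x ≤ b` is `0`. -/
def Orth (a b : M) : Prop := ∀ x : M, algLe x a → algLe x b → x = 0

/-- `X^⊥ = {s : s ⊥ x for all x ∈ X}`. -/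
def perpSet (X : Set M) : Set M := {s : M | ∀ x ∈ X, Orth s x}

/-- An ideal: a nonempty subset `I` with `a + b ∈ I ↔ a ∈ I ∧ b ∈ I`. -/
def IsIdeal (I : Set M) : Prop :=
  I.Nonempty ∧ ∀ a b : M, a + b ∈ I ↔ a ∈ I ∧ b ∈ I

/-- An additive endomorphism. -/
def IsAddEndo (p : M → M) : Prop :=
  p 0 = 0 ∧ ∀ x y : M, p (x + y) = p x + p y

/-- A projection: an additive endomorphism `p` such that every `x` can be written
`x = p x + y` with `y` orthogonal to every element of the range of `p`. -/
def IsProjection (p : M → M) : Prop :=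
  IsAddEndo p ∧ ∀ x : M, ∃ y : M, x = p x + y ∧ ∀ s : M, Orth y (p s)

/-- A complementary pair of projections. -/
def ComplPair (p q : M → M) : Prop :=
  IsAddEndo p ∧ IsAddEndo q ∧
    ∀ x : M, p x + q x = x ∧ p (q x) = 0 ∧ q (p x) = 0

/-- General comparability. -/
def GenComp (M : Type*) [AddCommMonoid M] : Prop :=
  ∀ a b : M, ∃ p q : M → M, ComplPair p q ∧ algLe (p a) (p b) ∧ algLe (q b) (q a)

/-- `S` is Boolean-valued. -/
def BoolValued (M : Type*) [AddCommMonoid M] : Prop :=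
  ∀ a b : M, ∃ p q : M → M, ComplPair p q ∧ algLe (p a) (p b) ∧
    ∀ p' q' : M → M, ComplPair p' q' → algLe (p' a) (p' b) →
      ∀ x : M, algLe (p' x) (p x)

/-- Directly finite element. -/
def DirectlyFinite (c : M) : Prop := ∀ x : M, x + c = c → x = 0

/-- Purely infinite element. -/
def PurelyInfinite (c : M) : Prop := c + c = c

/-- `b` is an infimum of `X` for the algebraic preorder. -/
def IsInfOf (b : M) (X : Set M) : Prop :=
  (∀ x ∈ X, algLe b x) ∧ ∀ y : M, (∀ x ∈ X, algLe y x) → algLe y b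

/-- `b` is a supremum of `X` for the algebraic preorder. -/
def IsSupOf (b : M) (X : Set M) : Prop :=
  (∀ x ∈ X, algLe x b) ∧ ∀ y : M, (∀ x ∈ X, algLe x y) → algLe b y

/-- Antisymmetry of the algebraic preorder. -/
def Antisymm (M : Type*) [AddCommMonoid M] : Prop :=
  ∀ a b : M, algLe a b → algLe b a → a = b

/-- Axiom (M5): every element is the sum of a directly finite element and a
purely infinite element. -/
def AxiomM5 (M : Type*) [AddCommMonoid M] : Prop :=
  ∀ a : M, ∃ x y : M, DirectlyFinite x ∧ PurelyInfinite y ∧ a = x + y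

/-- Axiom (M2): every nonempty subset has an infimum. -/
def AxiomM2 (M : Type*) [AddCommMonoid M] : Prop :=
  ∀ X : Set M, X.Nonempty → ∃ b : M, IsInfOf b X

theorem IsAddEndo.algLe_map {p : M → M} (hp : IsAddEndo p) {a b : M} (h : algLe a b) :
    algLe (p a) (p b) := by
  obtain ⟨c, rfl⟩ := h
  exact ⟨p c, (hp.2 a c).symm⟩

theorem algLe.add {a b c d : M} (h₁ : algLe a b) (h₂ : algLe c d) : algLe (a + c) (b + d) := by
  obtain ⟨x, rfl⟩ := h₁
  obtain ⟨y, rfl⟩ := h₂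
  exact ⟨x + y, add_add_add_comm a c x y⟩

theorem algLe.rfl {a : M} : algLe a a := ⟨0, add_zero a⟩

/-- To compare `x + y` with `a`, compare `x` with `p a` and `y` with `q a`. -/
theorem ComplPair.add_algLe {p q : M → M} (h : ComplPair p q) {x y a : M}
    (hx : algLe x (p a)) (hy : algLe y (q a)) : algLe (x + y) a := by
  simpa only [(h.2.2 a).1] using hx.add hy

/-- To compare `a` with `x + y`, compare `p a` with `x` and `q a` with `y`. -/
theorem ComplPair.algLe_add {p q : M → M} (h : ComplPair p q) {x y a : M}
    (hx : algLe (p a) x) (hy : algLe (q a) y) : algLe a (x + y) := by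
  simpa only [(h.2.2 a).1] using hx.add hy

theorem statement9 (hCon : Conical M) (hRef : Refinement M)
    (hAnti : Antisymm M) (hGC : GenComp M) :
    ∀ a b : M, (∃ c : M, IsInfOf c {a, b}) ∧ (∃ d : M, IsSupOf d {a, b}) := by
  intro a b
  obtain ⟨p, q, h, hab, hba⟩ := hGC a b
  refine ⟨⟨p a + q b, ?_, fun y hy => ?_⟩, ⟨p b + q a, ?_, fun y hy => ?_⟩⟩
  · rintro x (rfl | rfl)
    · exact h.add_algLe .rfl hba
    · exact h.add_algLe hab .rfl
  · exact h.algLe_add (h.1.algLe_map (hy a (.inl rfl))) (h.2.1.algLe_map (hy b (.inr rfl)))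
  · rintro x (rfl | rfl)
    · exact h.algLe_add hab .rfl
    · exact h.algLe_add .rfl hba
  · exact h.add_algLe (h.1.algLe_map (hy b (.inr rfl))) (h.2.1.algLe_map (hy a (.inl rfl)))

end PaperCDS
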